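/- arXiv:2102.08014 — 7 statements merged into one kernel-verified Lean document; each statement's English description precedes it below -/
import Mathlib

section
/- Let θ₁, θ₂, θ₃ ∈ [0, π] satisfy v(θ₁,θ₂,θ₃) ≠ 0, and let a₁, a₂, a₃ be real numbers. Then the set of triples (t₁, t₂, t₃) of nonnegative real numbers satisfying the system t₂² + t₃² − 2 t₂ t₃ cos θ₁ = a₁², t₃² + t₁² − 2 t₃ t₁ cos θ₂ = a₂², and t₁² + t₂² − 2 t₁ t₂ cos θ₃ = a₃² has at most four elements. -/
open Real

/-- The quantity `v(θ₁,θ₂,θ₃) = 1 + 2cosθ₁cosθ₂cosθ₃ − cos²θ₁ − cos²θ₂ − cos²θ₃`. -/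
noncomputable def vFun (θ₁ θ₂ θ₃ : ℝ) : ℝ :=
  1 + 2 * Real.cos θ₁ * Real.cos θ₂ * Real.cos θ₃
    - Real.cos θ₁ ^ 2 - Real.cos θ₂ ^ 2 - Real.cos θ₃ ^ 2

/-- A finite-dimensional algebra of real functions separating the points of a type bounds the
cardinality of that type by its dimension. -/
theorem finite_and_card_le_finrank_of_separates {α : Type*} (A : Subalgebra ℝ (α → ℝ))
    [FiniteDimensional ℝ A] (hA : ∀ a b : α, (∀ f ∈ A, f a = f b) → a = b) :
    Finite α ∧ Nat.card α ≤ Module.finrank ℝ A := by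
  classical
  have key : ∀ T : Finset α, T.card ≤ Module.finrank ℝ A := by
    intro T
    let φ : A →ₗ[ℝ] (T → ℝ) := (LinearMap.funLeft ℝ ℝ ((↑) : T → α)).comp A.val.toLinearMap
    have hsep : ∀ a b : α, ∃ f ∈ A, a ≠ b → f a = 1 ∧ f b = 0 := by
      intro a b
      by_cases hab : a = b
      · exact ⟨1, A.one_mem, fun h => absurd hab h⟩
      have : ∃ f ∈ A, f a ≠ f b := by
        by_contra! h
        exact hab (hA a b h)
      obtain ⟨f, hf, hne⟩ := this
      refine ⟨(f a - f b)⁻¹ • (f - algebraMap ℝ (α → ℝ) (f b)),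
        A.smul_mem (A.sub_mem hf (A.algebraMap_mem _)) _, fun _ => ?_⟩
      simp [sub_ne_zero.mpr hne]
    choose F hF hF' using hsep
    have hφ : Function.Surjective φ := by
      rw [← LinearMap.range_eq_top, eq_top_iff, ← (Pi.basisFun ℝ T).span_eq, Submodule.span_le]
      rintro _ ⟨i, rfl⟩
      refine ⟨⟨∏ j ∈ T.erase i, F i j, A.prod_mem fun j _ => hF _ _⟩, ?_⟩
      ext k
      simp only [φ, LinearMap.comp_apply, LinearMap.funLeft_apply, AlgHom.toLinearMap_apply,
        Subalgebra.coe_val, Finset.prod_apply, Pi.basisFun_apply]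
      by_cases hik : k = i
      · subst hik
        rw [Pi.single_eq_same]
        exact Finset.prod_eq_one fun j hj => (hF' _ _ (Finset.ne_of_mem_erase hj).symm).1
      · rw [Pi.single_eq_of_ne hik]
        have hne : (k : α) ≠ i := fun h => hik (Subtype.ext h)
        exact Finset.prod_eq_zero (Finset.mem_erase.mpr ⟨hne, k.2⟩) (hF' _ _ hne.symm).2
    simpa using φ.finrank_le_finrank_of_surjective hφ
  have hfin : Finite α := by
    by_contra h
    rw [not_finite_iff_infinite] at h
    obtain ⟨T, hT⟩ := Infinite.exists_subset_card_eq α (Module.finrank ℝ A + 1)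
    have := key T
    omega
  refine ⟨hfin, ?_⟩
  have := Fintype.ofFinite α
  simpa [Nat.card_eq_fintype_card] using key Finset.univ

/-- If three functions `p, q, r` play the role of `t₂t₃, t₃t₁, t₁t₂` for functions `tᵢ` subject to
the law-of-cosines equations with cosines `x, y, z`, then `1, p, q, r` span an algebra whenever
the Gram determinant of the cosines does not vanish. -/
theorem mul_mem_span_of_law_of_cosines {α : Type*} {x y z A B C : ℝ}
    (hv : 1 + 2 * x * y * z - x ^ 2 - y ^ 2 - z ^ 2 ≠ 0) (t₁ t₂ t₃ : α → ℝ)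
    (h₁ : ∀ i, t₂ i ^ 2 + t₃ i ^ 2 - 2 * t₂ i * t₃ i * x = A)
    (h₂ : ∀ i, t₃ i ^ 2 + t₁ i ^ 2 - 2 * t₃ i * t₁ i * y = B)
    (h₃ : ∀ i, t₁ i ^ 2 + t₂ i ^ 2 - 2 * t₁ i * t₂ i * z = C)
    {f g : α → ℝ}
    (hf : f ∈ Submodule.span ℝ (Set.range ![1, t₂ * t₃, t₃ * t₁, t₁ * t₂]))
    (hg : g ∈ Submodule.span ℝ (Set.range ![1, t₂ * t₃, t₃ * t₁, t₁ * t₂])) :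
    f * g ∈ Submodule.span ℝ (Set.range ![1, t₂ * t₃, t₃ * t₁, t₁ * t₂]) := by
  set W := Submodule.span ℝ (Set.range ![1, t₂ * t₃, t₃ * t₁, t₁ * t₂]) with hW
  set p := t₂ * t₃ with hp
  set q := t₃ * t₁ with hq
  set r := t₁ * t₂ with hr
  have hW1 : (1 : α → ℝ) ∈ W := Submodule.subset_span ⟨0, rfl⟩
  have hWp : p ∈ W := Submodule.subset_span ⟨1, rfl⟩
  have hWq : q ∈ W := Submodule.subset_span ⟨2, rfl⟩
  have hWr : r ∈ W := Submodule.subset_span ⟨3, rfl⟩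
  have affine_mem : ∀ c₀ c₁ c₂ c₃ : ℝ, c₀ • (1 : α → ℝ) + c₁ • p + c₂ • q + c₃ • r ∈ W :=
    fun c₀ c₁ c₂ c₃ => W.add_mem (W.add_mem (W.add_mem (W.smul_mem _ hW1) (W.smul_mem _ hWp))
      (W.smul_mem _ hWq)) (W.smul_mem _ hWr)
  obtain ⟨d₁, hd₁⟩ : ∃ d, d = (B + C - A) / 2 := ⟨_, rfl⟩
  obtain ⟨d₂, hd₂⟩ : ∃ d, d = (C + A - B) / 2 := ⟨_, rfl⟩
  obtain ⟨d₃, hd₃⟩ : ∃ d, d = (A + B - C) / 2 := ⟨_, rfl⟩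
  have s₁ : ∀ i, t₁ i ^ 2 = d₁ + y * q i + z * r i - x * p i := fun i => by
    simp only [hp, hq, hr, Pi.mul_apply]
    linear_combination (h₂ i + h₃ i - h₁ i) / 2 - hd₁
  have s₂ : ∀ i, t₂ i ^ 2 = d₂ + z * r i + x * p i - y * q i := fun i => by
    simp only [hp, hq, hr, Pi.mul_apply]
    linear_combination (h₃ i + h₁ i - h₂ i) / 2 - hd₂
  have s₃ : ∀ i, t₃ i ^ 2 = d₃ + x * p i + y * q i - z * r i := fun i => by
    simp only [hp, hq, hr, Pi.mul_apply]
    linear_combination (h₁ i + h₂ i - h₃ i) / 2 - hd₃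
  have m₁ : ∀ i, q i * r i = (d₁ + y * q i + z * r i - x * p i) * p i := fun i => by
    rw [← s₁]; simp only [hp, hq, hr, Pi.mul_apply]; ring
  have m₂ : ∀ i, r i * p i = (d₂ + z * r i + x * p i - y * q i) * q i := fun i => by
    rw [← s₂]; simp only [hp, hq, hr, Pi.mul_apply]; ring
  have m₃ : ∀ i, p i * q i = (d₃ + x * p i + y * q i - z * r i) * r i := fun i => by
    rw [← s₃]; simp only [hp, hq, hr, Pi.mul_apply]; ring
  have n₁ : ∀ i, p i ^ 2 = (d₂ + z * r i + x * p i - y * q i) *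
      (d₃ + x * p i + y * q i - z * r i) := fun i => by
    rw [← s₂, ← s₃]; simp only [hp, Pi.mul_apply]; ring
  have n₂ : ∀ i, q i ^ 2 = (d₃ + x * p i + y * q i - z * r i) *
      (d₁ + y * q i + z * r i - x * p i) := fun i => by
    rw [← s₃, ← s₁]; simp only [hq, Pi.mul_apply]; ring
  have n₃ : ∀ i, r i ^ 2 = (d₁ + y * q i + z * r i - x * p i) *
      (d₂ + z * r i + x * p i - y * q i) := fun i => by
    rw [← s₁, ← s₂]; simp only [hr, Pi.mul_apply]; ring
  clear_value p q r
  obtain ⟨e₁, he₁, he₁'⟩ : ∃ e ∈ W, ∀ i,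
      p i ^ 2 = -x * (q i * r i) + y * (r i * p i) + z * (p i * q i) + e i :=
    ⟨_, affine_mem (d₂ * d₃) (x * (d₁ + d₂ + d₃)) (-y * d₃) (-z * d₂), fun i => by
      simp only [Pi.add_apply, Pi.smul_apply, Pi.one_apply, smul_eq_mul]
      linear_combination n₁ i + x * m₁ i - y * m₂ i - z * m₃ i⟩
  obtain ⟨e₂, he₂, he₂'⟩ : ∃ e ∈ W, ∀ i,
      q i ^ 2 = x * (q i * r i) - y * (r i * p i) + z * (p i * q i) + e i :=
    ⟨_, affine_mem (d₃ * d₁) (-x * d₃) (y * (d₁ + d₂ + d₃)) (-z * d₁), fun i => by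
      simp only [Pi.add_apply, Pi.smul_apply, Pi.one_apply, smul_eq_mul]
      linear_combination n₂ i + y * m₂ i - z * m₃ i - x * m₁ i⟩
  obtain ⟨e₃, he₃, he₃'⟩ : ∃ e ∈ W, ∀ i,
      r i ^ 2 = x * (q i * r i) + y * (r i * p i) - z * (p i * q i) + e i :=
    ⟨_, affine_mem (d₁ * d₂) (-x * d₂) (-y * d₁) (z * (d₁ + d₂ + d₃)), fun i => by
      simp only [Pi.add_apply, Pi.smul_apply, Pi.one_apply, smul_eq_mul]
      linear_combination n₃ i + z * m₃ i - x * m₁ i - y * m₂ i⟩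
  have k₁ : ∀ i, (1 - x ^ 2) * (q i * r i) + (x * y - z) * (r i * p i)
      + (x * z - y) * (p i * q i) = d₁ * p i - x * e₁ i := fun i => by
    linear_combination m₁ i - x * he₁' i
  have k₂ : ∀ i, (x * y - z) * (q i * r i) + (1 - y ^ 2) * (r i * p i)
      + (y * z - x) * (p i * q i) = d₂ * q i - y * e₂ i := fun i => by
    linear_combination m₂ i - y * he₂' i
  have k₃ : ∀ i, (x * z - y) * (q i * r i) + (y * z - x) * (r i * p i)
      + (1 - z ^ 2) * (p i * q i) = d₃ * r i - z * e₃ i := fun i => by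
    linear_combination m₃ i - z * he₃' i
  have hf₁ : d₁ • p - x • e₁ ∈ W := W.sub_mem (W.smul_mem _ hWp) (W.smul_mem _ he₁)
  have hf₂ : d₂ • q - y • e₂ ∈ W := W.sub_mem (W.smul_mem _ hWq) (W.smul_mem _ he₂)
  have hf₃ : d₃ • r - z • e₃ ∈ W := W.sub_mem (W.smul_mem _ hWr) (W.smul_mem _ he₃)
  have hqr : q * r ∈ W := by
    rw [← W.smul_mem_iff hv]
    convert W.add_mem (W.add_mem hf₁ (W.smul_mem z hf₂)) (W.smul_mem y hf₃) using 1
    ext i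
    simp only [Pi.add_apply, Pi.sub_apply, Pi.smul_apply, Pi.mul_apply, smul_eq_mul]
    linear_combination k₁ i + z * k₂ i + y * k₃ i
  have hrp : r * p ∈ W := by
    rw [← W.smul_mem_iff hv]
    convert W.add_mem (W.add_mem (W.smul_mem z hf₁) hf₂) (W.smul_mem x hf₃) using 1
    ext i
    simp only [Pi.add_apply, Pi.sub_apply, Pi.smul_apply, Pi.mul_apply, smul_eq_mul]
    linear_combination z * k₁ i + k₂ i + x * k₃ i
  have hpq : p * q ∈ W := by
    rw [← W.smul_mem_iff hv]
    convert W.add_mem (W.add_mem (W.smul_mem y hf₁) (W.smul_mem x hf₂)) hf₃ using 1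
    ext i
    simp only [Pi.add_apply, Pi.sub_apply, Pi.smul_apply, Pi.mul_apply, smul_eq_mul]
    linear_combination y * k₁ i + x * k₂ i + k₃ i
  have mixed_mem : ∀ a b c : ℝ, ∀ e ∈ W, a • (q * r) + b • (r * p) + c • (p * q) + e ∈ W :=
    fun a b c e he => W.add_mem (W.add_mem (W.add_mem (W.smul_mem _ hqr) (W.smul_mem _ hrp))
      (W.smul_mem _ hpq)) he
  have hpp : p * p ∈ W := by
    convert mixed_mem (-x) y z e₁ he₁ using 1
    ext i
    simp only [Pi.add_apply, Pi.smul_apply, Pi.mul_apply, smul_eq_mul]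
    linear_combination he₁' i
  have hqq : q * q ∈ W := by
    convert mixed_mem x (-y) z e₂ he₂ using 1
    ext i
    simp only [Pi.add_apply, Pi.smul_apply, Pi.mul_apply, smul_eq_mul]
    linear_combination he₂' i
  have hrr : r * r ∈ W := by
    convert mixed_mem x y (-z) e₃ he₃ using 1
    ext i
    simp only [Pi.add_apply, Pi.smul_apply, Pi.mul_apply, smul_eq_mul]
    linear_combination he₃' i
  have hWW : W * W ≤ W := by
    conv_lhs => rw [hW, Submodule.span_mul_span]
    rw [Submodule.span_le]
    rintro _ ⟨_, ⟨i, rfl⟩, _, ⟨j, rfl⟩, rfl⟩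
    fin_cases i <;> fin_cases j <;>
      simp [hW1, hWp, hWq, hWr, hpp, hqq, hrr, hqr, hrp, hpq, mul_comm q p, mul_comm r q,
        mul_comm p r]
  exact hWW (Submodule.mul_mem_mul hf hg)

theorem stmt_0 (θ₁ θ₂ θ₃ : ℝ)
    (hθ₁ : θ₁ ∈ Set.Icc 0 Real.pi) (hθ₂ : θ₂ ∈ Set.Icc 0 Real.pi)
    (hθ₃ : θ₃ ∈ Set.Icc 0 Real.pi)
    (hv : vFun θ₁ θ₂ θ₃ ≠ 0) (a₁ a₂ a₃ : ℝ) :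
    letI S : Set (ℝ × ℝ × ℝ) :=
      {p | 0 ≤ p.1 ∧ 0 ≤ p.2.1 ∧ 0 ≤ p.2.2 ∧
        p.2.1 ^ 2 + p.2.2 ^ 2 - 2 * p.2.1 * p.2.2 * Real.cos θ₁ = a₁ ^ 2 ∧
        p.2.2 ^ 2 + p.1 ^ 2 - 2 * p.2.2 * p.1 * Real.cos θ₂ = a₂ ^ 2 ∧
        p.1 ^ 2 + p.2.1 ^ 2 - 2 * p.1 * p.2.1 * Real.cos θ₃ = a₃ ^ 2}
    S.Finite ∧ S.ncard ≤ 4 := by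
  set S : Set (ℝ × ℝ × ℝ) :=
    {p | 0 ≤ p.1 ∧ 0 ≤ p.2.1 ∧ 0 ≤ p.2.2 ∧
      p.2.1 ^ 2 + p.2.2 ^ 2 - 2 * p.2.1 * p.2.2 * Real.cos θ₁ = a₁ ^ 2 ∧
      p.2.2 ^ 2 + p.1 ^ 2 - 2 * p.2.2 * p.1 * Real.cos θ₂ = a₂ ^ 2 ∧
      p.1 ^ 2 + p.2.1 ^ 2 - 2 * p.1 * p.2.1 * Real.cos θ₃ = a₃ ^ 2}
  let t₁ : S → ℝ := fun i => i.1.1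
  let t₂ : S → ℝ := fun i => i.1.2.1
  let t₃ : S → ℝ := fun i => i.1.2.2
  have h₁ : ∀ i, t₂ i ^ 2 + t₃ i ^ 2 - 2 * t₂ i * t₃ i * Real.cos θ₁ = a₁ ^ 2 :=
    fun i => i.2.2.2.2.1
  have h₂ : ∀ i, t₃ i ^ 2 + t₁ i ^ 2 - 2 * t₃ i * t₁ i * Real.cos θ₂ = a₂ ^ 2 :=
    fun i => i.2.2.2.2.2.1
  have h₃ : ∀ i, t₁ i ^ 2 + t₂ i ^ 2 - 2 * t₁ i * t₂ i * Real.cos θ₃ = a₃ ^ 2 :=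
    fun i => i.2.2.2.2.2.2
  let W := Submodule.span ℝ (Set.range ![1, t₂ * t₃, t₃ * t₁, t₁ * t₂])
  let A : Subalgebra ℝ (S → ℝ) := W.toSubalgebra (Submodule.subset_span ⟨0, rfl⟩)
    fun _ _ hf hg => mul_mem_span_of_law_of_cosines hv t₁ t₂ t₃ h₁ h₂ h₃ hf hg
  have hfd : FiniteDimensional ℝ A :=
    FiniteDimensional.span_of_finite ℝ (Set.finite_range ![1, t₂ * t₃, t₃ * t₁, t₁ * t₂])
  have hrank : Module.finrank ℝ A ≤ 4 :=
    finrank_range_le_card (R := ℝ) ![1, t₂ * t₃, t₃ * t₁, t₁ * t₂]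
  have hsep : ∀ a b : S, (∀ f ∈ A, f a = f b) → a = b := by
    intro a b hab
    have hp : t₂ a * t₃ a = t₂ b * t₃ b := hab (t₂ * t₃) (Submodule.subset_span ⟨1, rfl⟩)
    have hq : t₃ a * t₁ a = t₃ b * t₁ b := hab (t₃ * t₁) (Submodule.subset_span ⟨2, rfl⟩)
    have hr : t₁ a * t₂ a = t₁ b * t₂ b := hab (t₁ * t₂) (Submodule.subset_span ⟨3, rfl⟩)
    have e₁ : t₂ a ^ 2 + t₃ a ^ 2 = t₂ b ^ 2 + t₃ b ^ 2 := by
      linear_combination h₁ a - h₁ b + 2 * Real.cos θ₁ * hp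
    have e₂ : t₃ a ^ 2 + t₁ a ^ 2 = t₃ b ^ 2 + t₁ b ^ 2 := by
      linear_combination h₂ a - h₂ b + 2 * Real.cos θ₂ * hq
    have e₃ : t₁ a ^ 2 + t₂ a ^ 2 = t₁ b ^ 2 + t₂ b ^ 2 := by
      linear_combination h₃ a - h₃ b + 2 * Real.cos θ₃ * hr
    have u₁ : t₁ a = t₁ b := (sq_eq_sq₀ a.2.1 b.2.1).mp (by linarith)
    have u₂ : t₂ a = t₂ b := (sq_eq_sq₀ a.2.2.1 b.2.2.1).mp (by linarith)
    have u₃ : t₃ a = t₃ b := (sq_eq_sq₀ a.2.2.2.1 b.2.2.2.1).mp (by linarith)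
    exact Subtype.ext (Prod.ext u₁ (Prod.ext u₂ u₃))
  obtain ⟨hfin, hcard⟩ := finite_and_card_le_finrank_of_separates A hsep
  exact ⟨hfin, hcard.trans hrank⟩
end

section
/- Let (Z, d_Z) be a metric space, β > 0, n ≥ 3, and let z₁, …, zₙ ∈ Z satisfy d_Z(z_i, z_j) ≥ β/2 for all i ≠ j. For x, y ∈ Z and s, t ∈ [0,1], define the cone distance d̃_β((x,s),(y,t)) := β·√(t² + s² − 2 t s · cos(π · min(d_Z(x,y)/β, 1))). If (t₁, …, tₙ) and (t′₁, …, t′ₙ) are two vectors in [0,1]ⁿ with d̃_β((z_i, t_i), (z_j, t_j)) = d̃_β((z_i, t′_i), (z_j, t′_j)) for all i, j, then t_i = t′_i for every i. -/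
/-- The metric cone distance over a metric space `Z` with parameter `β`:
`d̃_β((x,s),(y,t)) = β·√(t² + s² − 2ts·cos(π·min(d_Z(x,y)/β, 1)))`. -/
noncomputable def coneDist {Z : Type*} [MetricSpace Z] (β : ℝ) (x : Z) (s : ℝ)
    (y : Z) (t : ℝ) : ℝ :=
  β * Real.sqrt (t ^ 2 + s ^ 2 -
    2 * t * s * Real.cos (Real.pi * min (dist x y / β) 1))

/-- Cone distances over a fixed pair of base points agree iff their radicands do. -/
theorem coneDist_eq_coneDist_iff {Z : Type*} [MetricSpace Z] {β : ℝ} (hβ : 0 < β)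
    (x y : Z) (s t s' t' : ℝ) :
    coneDist β x s y t = coneDist β x s' y t' ↔
      t ^ 2 + s ^ 2 - 2 * t * s * Real.cos (Real.pi * min (dist x y / β) 1) =
        t' ^ 2 + s' ^ 2 - 2 * t' * s' * Real.cos (Real.pi * min (dist x y / β) 1) := by
  have radicand_nonneg (a b θ : ℝ) : 0 ≤ a ^ 2 + b ^ 2 - 2 * a * b * Real.cos θ := by
    nlinarith [sq_nonneg (a - b * Real.cos θ), Real.sin_sq_add_cos_sq θ,
      sq_nonneg (b * Real.sin θ)]
  unfold coneDist
  rw [mul_right_inj' hβ.ne', Real.sqrt_inj (radicand_nonneg _ _ _) (radicand_nonneg _ _ _)]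

/-- Base points at distance at least `β / 2` span an angle at least `π / 2` at the apex. -/
theorem cos_pi_mul_min_dist_div_nonpos {Z : Type*} [MetricSpace Z] {β : ℝ} (hβ : 0 < β)
    {x y : Z} (hxy : β / 2 ≤ dist x y) :
    Real.cos (Real.pi * min (dist x y / β) 1) ≤ 0 := by
  have half_le : 1 / 2 ≤ min (dist x y / β) 1 := by
    refine le_min ?_ (by norm_num)
    rw [le_div_iff₀ hβ]
    linarith
  have le_one : min (dist x y / β) 1 ≤ 1 := min_le_right _ _
  apply Real.cos_nonpos_of_pi_div_two_le_of_le <;> nlinarith [Real.pi_pos]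

/-- Over base points at distance at least `β / 2`, raising one height at constant cone distance
forces the other height to drop. -/
theorem lt_of_coneDist_eq_of_lt {Z : Type*} [MetricSpace Z] {β : ℝ} (hβ : 0 < β)
    {x y : Z} (hxy : β / 2 ≤ dist x y) {s t s' t' : ℝ} (hs : 0 ≤ s) (ht : 0 ≤ t)
    (h : coneDist β x s y t = coneDist β x s' y t') (hss' : s < s') : t' < t := by
  by_contra! htt'
  rw [coneDist_eq_coneDist_iff hβ] at h
  have hcos := cos_pi_mul_min_dist_div_nonpos hβ hxy
  have hmul : t * s ≤ t' * s' := mul_le_mul htt' hss'.le hs (ht.trans htt')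
  nlinarith [mul_nonneg (sub_nonneg.2 hmul) (neg_nonneg.2 hcos)]

theorem stmt_3 {Z : Type*} [MetricSpace Z] (β : ℝ) (hβ : 0 < β)
    (n : ℕ) (hn : 3 ≤ n) (z : Fin n → Z)
    (hz : ∀ i j, i ≠ j → β / 2 ≤ dist (z i) (z j))
    (t t' : Fin n → ℝ)
    (ht : ∀ i, t i ∈ Set.Icc (0 : ℝ) 1) (ht' : ∀ i, t' i ∈ Set.Icc (0 : ℝ) 1)
    (hd : ∀ i j, coneDist β (z i) (t i) (z j) (t j)
      = coneDist β (z i) (t' i) (z j) (t' j)) :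
    ∀ i, t i = t' i := by
  intro i
  obtain ⟨j, hji, k, hki, hkj⟩ : ∃ j, j ≠ i ∧ ∃ k, k ≠ i ∧ k ≠ j := by
    obtain ⟨j, hj⟩ := Finset.exists_mem_notMem_of_card_lt_card
      (s := {i}) (t := Finset.univ) (by simp; omega)
    obtain ⟨k, hk⟩ := Finset.exists_mem_notMem_of_card_lt_card
      (s := {i, j}) (t := Finset.univ) (Finset.card_le_two.trans_lt (by simp; omega))
    simp only [Finset.mem_univ, Finset.mem_singleton, Finset.mem_insert, true_and, not_or] at hj hk
    exact ⟨j, hj, k, hk⟩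
  have drop {a b : Fin n} (hab : b ≠ a) (h : t a < t' a) : t' b < t b :=
    lt_of_coneDist_eq_of_lt hβ (hz a b hab.symm) (ht a).1 (ht b).1 (hd a b) h
  have rise {a b : Fin n} (hab : b ≠ a) (h : t' a < t a) : t b < t' b :=
    lt_of_coneDist_eq_of_lt hβ (hz a b hab.symm) (ht' a).1 (ht' b).1 (hd a b).symm h
  rcases lt_trichotomy (t i) (t' i) with h | h | h
  · exact absurd (drop hki h) (rise hkj (drop hji h)).asymm
  · exact h
  · exact absurd (rise hki h) (drop hkj (rise hji h)).asymm
end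

section
/- Let θ₁, θ₂, θ₃ ∈ [π/2, π] and let a₁, a₂, a₃ be real numbers. Then there is at most one triple (t₁, t₂, t₃) of nonnegative real numbers satisfying t₂² + t₃² − 2 t₂ t₃ cos θ₁ = a₁², t₃² + t₁² − 2 t₃ t₁ cos θ₂ = a₂², and t₁² + t₂² − 2 t₁ t₂ cos θ₃ = a₃². -/
/-- For `c ≤ 0`, the law-of-cosines form is strictly monotone on the nonnegative quadrant. -/
theorem eq_and_eq_of_le_of_lawCos_eq {c x y x' y' : ℝ} (hc : c ≤ 0) (hx : 0 ≤ x) (hy : 0 ≤ y)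
    (hxx : x ≤ x') (hyy : y ≤ y')
    (h : x ^ 2 + y ^ 2 - 2 * x * y * c = x' ^ 2 + y' ^ 2 - 2 * x' * y' * c) :
    x = x' ∧ y = y' := by
  have hxy : x * y ≤ x' * y' := mul_le_mul hxx hyy hy (hx.trans hxx)
  have hcxy : 0 ≤ (x' * y' - x * y) * -c := mul_nonneg (sub_nonneg.2 hxy) (neg_nonneg.2 hc)
  have hx2 : x ^ 2 ≤ x' ^ 2 := pow_le_pow_left₀ hx hxx 2
  have hy2 : y ^ 2 ≤ y' ^ 2 := pow_le_pow_left₀ hy hyy 2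
  constructor
  · exact hxx.antisymm (abs_le_of_sq_le_sq' (by linarith) hx).2
  · exact hyy.antisymm (abs_le_of_sq_le_sq' (by linarith) hy).2

theorem stmt_4 (θ₁ θ₂ θ₃ : ℝ)
    (hθ₁ : θ₁ ∈ Set.Icc (Real.pi / 2) Real.pi)
    (hθ₂ : θ₂ ∈ Set.Icc (Real.pi / 2) Real.pi)
    (hθ₃ : θ₃ ∈ Set.Icc (Real.pi / 2) Real.pi)
    (a₁ a₂ a₃ : ℝ)
    (t₁ t₂ t₃ t₁' t₂' t₃' : ℝ)
    (ht₁ : 0 ≤ t₁) (ht₂ : 0 ≤ t₂) (ht₃ : 0 ≤ t₃)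
    (ht₁' : 0 ≤ t₁') (ht₂' : 0 ≤ t₂') (ht₃' : 0 ≤ t₃')
    (h1 : t₂ ^ 2 + t₃ ^ 2 - 2 * t₂ * t₃ * Real.cos θ₁ = a₁ ^ 2)
    (h2 : t₃ ^ 2 + t₁ ^ 2 - 2 * t₃ * t₁ * Real.cos θ₂ = a₂ ^ 2)
    (h3 : t₁ ^ 2 + t₂ ^ 2 - 2 * t₁ * t₂ * Real.cos θ₃ = a₃ ^ 2)
    (h1' : t₂' ^ 2 + t₃' ^ 2 - 2 * t₂' * t₃' * Real.cos θ₁ = a₁ ^ 2)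
    (h2' : t₃' ^ 2 + t₁' ^ 2 - 2 * t₃' * t₁' * Real.cos θ₂ = a₂ ^ 2)
    (h3' : t₁' ^ 2 + t₂' ^ 2 - 2 * t₁' * t₂' * Real.cos θ₃ = a₃ ^ 2) :
    t₁ = t₁' ∧ t₂ = t₂' ∧ t₃ = t₃' := by
  have cos_nonpos : ∀ {θ : ℝ}, θ ∈ Set.Icc (Real.pi / 2) Real.pi → Real.cos θ ≤ 0 := fun h =>
    Real.cos_nonpos_of_pi_div_two_le_of_le h.1 (by linarith [h.2, Real.pi_pos])
  have hc₁ := cos_nonpos hθ₁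
  have hc₂ := cos_nonpos hθ₂
  have hc₃ := cos_nonpos hθ₃
  have e₁ := h1.trans h1'.symm
  have e₂ := h2.trans h2'.symm
  have e₃ := h3.trans h3'.symm
  have le₁ := eq_and_eq_of_le_of_lawCos_eq hc₁ ht₂ ht₃ (h := e₁)
  have le₂ := eq_and_eq_of_le_of_lawCos_eq hc₂ ht₃ ht₁ (h := e₂)
  have le₃ := eq_and_eq_of_le_of_lawCos_eq hc₃ ht₁ ht₂ (h := e₃)
  have ge₁ := eq_and_eq_of_le_of_lawCos_eq hc₁ ht₂' ht₃' (h := e₁.symm)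
  have ge₂ := eq_and_eq_of_le_of_lawCos_eq hc₂ ht₃' ht₁' (h := e₂.symm)
  have ge₃ := eq_and_eq_of_le_of_lawCos_eq hc₃ ht₁' ht₂' (h := e₃.symm)
  clear * - le₁ le₂ le₃ ge₁ ge₂ ge₃
  grind
end

section
/- Let θ₁, θ₂, θ₃ ∈ [0, π] satisfy v(θ₁,θ₂,θ₃) ≠ 0, and let a₁, a₂, a₃ be real numbers. Then the set of complex triples (t₁, t₂, t₃) ∈ ℂ³ satisfying t₂² + t₃² − 2 t₂ t₃ cos θ₁ = a₁², t₃² + t₁² − 2 t₃ t₁ cos θ₂ = a₂², and t₁² + t₂² − 2 t₁ t₂ cos θ₃ = a₃² is finite and has at most 8 elements. -/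
variable {K A : Type*} [Field K] [CommRing A] [Algebra K A]

/-- The span of the square-free monomials in `x`, `y`, `z`. -/
def squarefreeSpan (K : Type*) {A : Type*} [Field K] [CommRing A] [Algebra K A] (x y z : A) :
    Submodule K A :=
  Submodule.span K (Set.range ![1, x, y, z, y * z, z * x, x * y, x * y * z])

theorem squarefreeSpan_rotate (x y z : A) :
    squarefreeSpan K y z x = squarefreeSpan K x y z := by
  unfold squarefreeSpan
  congr 1
  ext m
  simp only [Matrix.range_cons, Matrix.range_empty, Set.union_empty, Set.mem_union,
    Set.mem_singleton_iff]
  rw [show y * z * x = x * y * z by ring]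
  tauto

theorem mul_left_mem_squarefreeSpan {x y z : A} {a b c d e f : K}
    (hx : x ^ 2 = b • (z * x) + c • (x * y) - a • (y * z) + d • 1)
    (hy : y ^ 2 = c • (x * y) + a • (y * z) - b • (z * x) + e • 1)
    (hz : z ^ 2 = a • (y * z) + b • (z * x) - c • (x * y) + f • 1)
    (h2 : (2 : K) ≠ 0)
    (hv : 1 + 2 * a * b * c - a ^ 2 - b ^ 2 - c ^ 2 ≠ 0) {m : A}
    (hm : m ∈ squarefreeSpan K x y z) : x * m ∈ squarefreeSpan K x y z := by
  set M := squarefreeSpan K x y z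
  have mem (i) : ![1, x, y, z, y * z, z * x, x * y, x * y * z] i ∈ M :=
    Submodule.subset_span ⟨i, rfl⟩
  have m1 : (1 : A) ∈ M := mem 0
  have mx : x ∈ M := mem 1
  have my : y ∈ M := mem 2
  have mz : z ∈ M := mem 3
  have myz : y * z ∈ M := mem 4
  have mzx : z * x ∈ M := mem 5
  have mxy : x * y ∈ M := mem 6
  have mw : x * y * z ∈ M := mem 7
  have mxx : x ^ 2 ∈ M := by
    rw [hx]
    exact M.add_mem (M.sub_mem (M.add_mem (M.smul_mem _ mzx) (M.smul_mem _ mxy))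
      (M.smul_mem _ myz)) (M.smul_mem _ m1)
  have myy : y ^ 2 ∈ M := by
    rw [hy]
    exact M.add_mem (M.sub_mem (M.add_mem (M.smul_mem _ mxy) (M.smul_mem _ myz))
      (M.smul_mem _ mzx)) (M.smul_mem _ m1)
  have mzz : z ^ 2 ∈ M := by
    rw [hz]
    exact M.add_mem (M.sub_mem (M.add_mem (M.smul_mem _ myz) (M.smul_mem _ mzx))
      (M.smul_mem _ mxy)) (M.smul_mem _ m1)
  have cancel {k : K} (hk : k ≠ 0) {n : A} (h : k • n ∈ M) : n ∈ M :=
    (M.smul_mem_iff hk).1 h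
  simp only [Algebra.smul_def] at hx hy hz
  -- the cubic monomials `x ^ 2 * y`, `x * y ^ 2`, `y ^ 2 * z` solve a system with determinant `v`
  have e₁ : x ^ 2 * y - c • (x * y ^ 2) + a • (y ^ 2 * z) ∈ M := by
    convert M.add_mem (M.smul_mem b mw) (M.smul_mem d my) using 1
    simp only [Algebra.smul_def]
    linear_combination y * hx
  have e₂ : x * y ^ 2 - c • (x ^ 2 * y) - b • (y ^ 2 * z) ∈ M := by
    convert M.add_mem (M.smul_mem (a - 2 * b * c) mw)
      (M.sub_mem (M.smul_mem e mx) (M.smul_mem (b * (d + e)) mz)) using 1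
    simp only [Algebra.smul_def, map_sub, map_mul, map_add, map_ofNat]
    linear_combination x * hy - algebraMap K A b * z * (hx + hy)
  have e₃ : y ^ 2 * z + a • (x ^ 2 * y) - b • (x * y ^ 2) ∈ M := by
    convert M.add_mem (M.smul_mem c mw) (M.add_mem (M.smul_mem e mz)
      (M.sub_mem (M.smul_mem (a * (d + f)) my) (M.smul_mem (b * (e + f)) mx))) using 1
    simp only [Algebra.smul_def, map_mul, map_add]
    linear_combination z * hy + algebraMap K A a * y * (hx + hz)
      - algebraMap K A b * x * (hy + hz)
  have mxxy : x ^ 2 * y ∈ M := by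
    refine cancel hv ?_
    convert M.add_mem (M.add_mem (M.smul_mem (1 - b ^ 2) e₁) (M.smul_mem (c - a * b) e₂))
      (M.smul_mem (b * c - a) e₃) using 1
    module
  have mxyy : x * y ^ 2 ∈ M := by
    refine cancel hv ?_
    convert M.add_mem (M.add_mem (M.smul_mem (c - a * b) e₁) (M.smul_mem (1 - a ^ 2) e₂))
      (M.smul_mem (b - a * c) e₃) using 1
    module
  have myyz : y ^ 2 * z ∈ M := by
    refine cancel hv ?_
    convert M.add_mem (M.add_mem (M.smul_mem (b * c - a) e₁) (M.smul_mem (b - a * c) e₂))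
      (M.smul_mem (1 - c ^ 2) e₃) using 1
    module
  have mxxz : x ^ 2 * z ∈ M := by
    convert M.sub_mem (M.add_mem (M.smul_mem (2 * c) mw) (M.smul_mem (d + e) mz)) myyz using 1
    simp only [Algebra.smul_def, map_mul, map_add, map_ofNat]
    linear_combination z * (hx + hy)
  -- likewise for the quartic monomials `x ^ 2 * y * z`, `x * y ^ 2 * z`, `x * y * z ^ 2`
  have f₁ : (2 : K) • ((1 - a ^ 2) • (x ^ 2 * y * z) + (a * b - c) • (x * y ^ 2 * z)
      + (a * c - b) • (x * y * z ^ 2)) ∈ M := by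
    convert M.sub_mem (M.smul_mem (2 * d) myz) (M.smul_mem a (M.sub_mem (M.add_mem
      (M.smul_mem (d + e) mzz) (M.smul_mem (d + f) myy)) (M.smul_mem (e + f) mxx))) using 1
    simp only [Algebra.smul_def, map_mul, map_add, map_sub, map_pow, map_one, map_ofNat]
    linear_combination 2 * y * z * hx - algebraMap K A a * (z ^ 2 * (hx + hy)
      + y ^ 2 * (hx + hz) - x ^ 2 * (hy + hz))
  have f₂ : (2 : K) • ((a * b - c) • (x ^ 2 * y * z) + (1 - b ^ 2) • (x * y ^ 2 * z)
      + (b * c - a) • (x * y * z ^ 2)) ∈ M := by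
    convert M.sub_mem (M.smul_mem (2 * e) mzx) (M.smul_mem b (M.sub_mem (M.add_mem
      (M.smul_mem (d + e) mzz) (M.smul_mem (e + f) mxx)) (M.smul_mem (d + f) myy))) using 1
    simp only [Algebra.smul_def, map_mul, map_add, map_sub, map_pow, map_one, map_ofNat]
    linear_combination 2 * x * z * hy - algebraMap K A b * (z ^ 2 * (hx + hy)
      + x ^ 2 * (hy + hz) - y ^ 2 * (hx + hz))
  have f₃ : (2 : K) • ((a * c - b) • (x ^ 2 * y * z) + (b * c - a) • (x * y ^ 2 * z)
      + (1 - c ^ 2) • (x * y * z ^ 2)) ∈ M := by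
    convert M.sub_mem (M.smul_mem (2 * f) mxy) (M.smul_mem c (M.sub_mem (M.add_mem
      (M.smul_mem (e + f) mxx) (M.smul_mem (d + f) myy)) (M.smul_mem (d + e) mzz))) using 1
    simp only [Algebra.smul_def, map_mul, map_add, map_sub, map_pow, map_one, map_ofNat]
    linear_combination 2 * x * y * hz - algebraMap K A c * (x ^ 2 * (hy + hz)
      + y ^ 2 * (hx + hz) - z ^ 2 * (hx + hy))
  have mxw : x ^ 2 * y * z ∈ M := by
    refine cancel hv (cancel h2 ?_)
    convert M.add_mem (M.add_mem f₁ (M.smul_mem c f₂)) (M.smul_mem b f₃) using 1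
    module
  induction hm using Submodule.span_induction with
  | mem m hm =>
    obtain ⟨i, rfl⟩ := hm
    fin_cases i
    · simpa using mx
    · simpa [sq] using mxx
    · simpa using mxy
    · simpa [mul_comm] using mzx
    · simpa [mul_assoc] using mw
    · change x * (z * x) ∈ M
      rwa [show x * (z * x) = x ^ 2 * z by ring]
    · change x * (x * y) ∈ M
      rwa [show x * (x * y) = x ^ 2 * y by ring]
    · change x * (x * y * z) ∈ M
      rwa [show x * (x * y * z) = x ^ 2 * y * z by ring]
  | zero => simp
  | add m n _ _ hm hn => simpa [mul_add] using M.add_mem hm hn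
  | smul k m _ hm => simpa using M.smul_mem k hm

theorem adjoin_le_squarefreeSpan {x y z : A} {a b c d e f : K}
    (hx : x ^ 2 = b • (z * x) + c • (x * y) - a • (y * z) + d • 1)
    (hy : y ^ 2 = c • (x * y) + a • (y * z) - b • (z * x) + e • 1)
    (hz : z ^ 2 = a • (y * z) + b • (z * x) - c • (x * y) + f • 1)
    (h2 : (2 : K) ≠ 0)
    (hv : 1 + 2 * a * b * c - a ^ 2 - b ^ 2 - c ^ 2 ≠ 0) :
    Subalgebra.toSubmodule (Algebra.adjoin K {x, y, z}) ≤ squarefreeSpan K x y z := by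
  have rot := squarefreeSpan_rotate (K := K) x y z
  have rot' := (squarefreeSpan_rotate (K := K) y z x).trans rot
  have key : ∀ u ∈ Algebra.adjoin K {x, y, z}, ∀ m ∈ squarefreeSpan K x y z,
      u * m ∈ squarefreeSpan K x y z := by
    intro u hu
    induction hu using Algebra.adjoin_induction with
    | mem u hu =>
      intro m hm
      rcases hu with rfl | rfl | rfl
      · exact mul_left_mem_squarefreeSpan hx hy hz h2 hv hm
      · rw [← rot] at hm ⊢
        exact mul_left_mem_squarefreeSpan hy hz hx h2 (by convert hv using 1; ring) hm
      · rw [← rot'] at hm ⊢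
        exact mul_left_mem_squarefreeSpan hz hx hy h2 (by convert hv using 1; ring) hm
    | algebraMap k =>
      intro m hm
      rw [← Algebra.smul_def]
      exact Submodule.smul_mem _ _ hm
    | add u w _ _ hu hw =>
      intro m hm
      rw [add_mul]
      exact Submodule.add_mem _ (hu m hm) (hw m hm)
    | mul u w _ _ hu hw =>
      intro m hm
      rw [mul_assoc]
      exact hu _ (hw m hm)
  intro u hu
  simpa using key u hu 1 (Submodule.subset_span ⟨0, rfl⟩)

theorem finite_and_ncard_le_of_adjoin_le {S : Set (K × K × K)} {n : ℕ}
    {M : Submodule K (S → K)} [FiniteDimensional K M] (hn : Module.finrank K M ≤ n)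
    (hM : Subalgebra.toSubmodule (Algebra.adjoin K
      {fun p : S => p.1.1, fun p : S => p.1.2.1, fun p : S => p.1.2.2}) ≤ M) :
    S.Finite ∧ S.ncard ≤ n := by
  set B := Algebra.adjoin K {fun p : S => p.1.1, fun p : S => p.1.2.1, fun p : S => p.1.2.2}
  have : FiniteDimensional K B := Submodule.finiteDimensional_of_le hM
  have hfin : Module.finrank K B ≤ n := (Submodule.finrank_mono hM).trans hn
  let ev (p : S) : B →ₐ[K] K := (Pi.evalAlgHom K (fun _ : S => K) p).comp B.val
  have hev : Function.Injective ev := by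
    intro p q h
    have h' (g : S → K) (hg : g ∈ B) : g p = g q := DFunLike.congr_fun h (⟨g, hg⟩ : B)
    refine Subtype.ext (Prod.ext ?_ (Prod.ext ?_ ?_))
    · exact h' (fun p => p.1.1) (Algebra.subset_adjoin (by simp))
    · exact h' (fun p => p.1.2.1) (Algebra.subset_adjoin (by simp))
    · exact h' (fun p => p.1.2.2) (Algebra.subset_adjoin (by simp))
  have hli := (linearIndependent_algHom_toLinearMap K B K).comp ev hev
  have : Finite S := hli.finite
  have := Fintype.ofFinite S
  refine ⟨S.toFinite, ?_⟩
  rw [← Nat.card_coe_set_eq, Nat.card_eq_fintype_card]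
  calc Fintype.card S ≤ Module.finrank K (B →ₗ[K] K) := hli.fintype_card_le_finrank
    _ = Module.finrank K B := Subspace.dual_finrank_eq
    _ ≤ n := hfin

instance finiteDimensional_squarefreeSpan (x y z : A) :
    FiniteDimensional K (squarefreeSpan K x y z) :=
  FiniteDimensional.span_of_finite K (Set.finite_range _)

theorem finrank_squarefreeSpan_le (x y z : A) :
    Module.finrank K (squarefreeSpan K x y z) ≤ 8 :=
  (finrank_range_le_card (R := K) ![1, x, y, z, y * z, z * x, x * y, x * y * z]).trans_eq
    (Fintype.card_fin 8)

theorem stmt_6 (θ₁ θ₂ θ₃ : ℝ)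
    (hθ₁ : θ₁ ∈ Set.Icc 0 Real.pi) (hθ₂ : θ₂ ∈ Set.Icc 0 Real.pi)
    (hθ₃ : θ₃ ∈ Set.Icc 0 Real.pi)
    (hv : vFun θ₁ θ₂ θ₃ ≠ 0) (a₁ a₂ a₃ : ℝ) :
    letI S : Set (ℂ × ℂ × ℂ) :=
      {p | p.2.1 ^ 2 + p.2.2 ^ 2 - 2 * p.2.1 * p.2.2 * (Real.cos θ₁ : ℂ)
            = (a₁ : ℂ) ^ 2 ∧
          p.2.2 ^ 2 + p.1 ^ 2 - 2 * p.2.2 * p.1 * (Real.cos θ₂ : ℂ)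
            = (a₂ : ℂ) ^ 2 ∧
          p.1 ^ 2 + p.2.1 ^ 2 - 2 * p.1 * p.2.1 * (Real.cos θ₃ : ℂ)
            = (a₃ : ℂ) ^ 2}
    S.Finite ∧ S.ncard ≤ 8 := by
  refine finite_and_ncard_le_of_adjoin_le (finrank_squarefreeSpan_le _ _ _)
    (adjoin_le_squarefreeSpan (a := (Real.cos θ₁ : ℂ)) (b := (Real.cos θ₂ : ℂ))
      (c := (Real.cos θ₃ : ℂ))
      (d := ((a₂ : ℂ) ^ 2 + (a₃ : ℂ) ^ 2 - (a₁ : ℂ) ^ 2) / 2)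
      (e := ((a₃ : ℂ) ^ 2 + (a₁ : ℂ) ^ 2 - (a₂ : ℂ) ^ 2) / 2)
      (f := ((a₁ : ℂ) ^ 2 + (a₂ : ℂ) ^ 2 - (a₃ : ℂ) ^ 2) / 2) ?_ ?_ ?_ two_ne_zero ?_)
  · funext ⟨p, h₁, h₂, h₃⟩
    simp only [Pi.pow_apply, Pi.add_apply, Pi.sub_apply, Pi.smul_apply, Pi.mul_apply,
      Pi.one_apply, smul_eq_mul]
    linear_combination (h₂ + h₃ - h₁) / 2
  · funext ⟨p, h₁, h₂, h₃⟩
    simp only [Pi.pow_apply, Pi.add_apply, Pi.sub_apply, Pi.smul_apply, Pi.mul_apply,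
      Pi.one_apply, smul_eq_mul]
    linear_combination (h₃ + h₁ - h₂) / 2
  · funext ⟨p, h₁, h₂, h₃⟩
    simp only [Pi.pow_apply, Pi.add_apply, Pi.sub_apply, Pi.smul_apply, Pi.mul_apply,
      Pi.one_apply, smul_eq_mul]
    linear_combination (h₁ + h₂ - h₃) / 2
  · unfold vFun at hv
    exact_mod_cast hv
end

section
/- If (t₁, t₂, t₃) ∈ ℂ³ satisfies the system t₂² + t₃² − 2 t₂ t₃ cos θ₁ = a₁², t₃² + t₁² − 2 t₃ t₁ cos θ₂ = a₂², t₁² + t₂² − 2 t₁ t₂ cos θ₃ = a₃² (for fixed real θ₁, θ₂, θ₃ and a₁, a₂, a₃), then (−t₁, −t₂, −t₃) also satisfies the same system; consequently, if the complex solution set of the system is finite with at most 8 elements, then the set of solutions with all three coordinates real and nonnegative has at most 4 elements. -/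
/-- A subset of a finite symmetric set that contains at most one element of each antipodal pair
has at most half as many elements, up to a possible fixed point `a`. -/
theorem two_mul_ncard_le_of_inter_neg_subset {G : Type*} [InvolutiveNeg G] {S T : Set G} {a : G}
    (hS : S.Finite) (hneg : ∀ x ∈ S, -x ∈ S) (hT : T ⊆ S) (hinter : T ∩ Neg.neg '' T ⊆ {a}) :
    2 * T.ncard ≤ S.ncard + 1 := by
  have hTfin : T.Finite := hS.subset hT
  have hunion : (T ∪ Neg.neg '' T).ncard ≤ S.ncard :=
    Set.ncard_le_ncard
      (Set.union_subset hT (Set.image_subset_iff.2 fun x hx => hneg x (hT hx))) hS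
  have hone : (T ∩ Neg.neg '' T).ncard ≤ 1 :=
    (Set.ncard_le_ncard hinter).trans (Set.ncard_singleton a).le
  have hcard := Set.ncard_union_add_ncard_inter T (Neg.neg '' T) hTfin (hTfin.image _)
  rw [Set.ncard_image_of_injective T neg_injective] at hcard
  omega

theorem Complex.eq_zero_of_nonneg_of_neg {z : ℂ} (hz : z.im = 0 ∧ 0 ≤ z.re)
    (hz' : 0 ≤ (-z).re) : z = 0 := by
  rw [Complex.neg_re] at hz'
  exact Complex.ext (by simpa using le_antisymm (by linarith) hz.2) hz.1


theorem stmt_7 (θ₁ θ₂ θ₃ a₁ a₂ a₃ : ℝ) :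
    letI S : Set (ℂ × ℂ × ℂ) :=
      {p | p.2.1 ^ 2 + p.2.2 ^ 2 - 2 * p.2.1 * p.2.2 * (Real.cos θ₁ : ℂ)
            = (a₁ : ℂ) ^ 2 ∧
          p.2.2 ^ 2 + p.1 ^ 2 - 2 * p.2.2 * p.1 * (Real.cos θ₂ : ℂ)
            = (a₂ : ℂ) ^ 2 ∧
          p.1 ^ 2 + p.2.1 ^ 2 - 2 * p.1 * p.2.1 * (Real.cos θ₃ : ℂ)
            = (a₃ : ℂ) ^ 2}
    (∀ p : ℂ × ℂ × ℂ, p ∈ S → (-p.1, -p.2.1, -p.2.2) ∈ S) ∧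
      (S.Finite → S.ncard ≤ 8 →
        ({p ∈ S | (p.1.im = 0 ∧ 0 ≤ p.1.re) ∧ (p.2.1.im = 0 ∧ 0 ≤ p.2.1.re) ∧
          (p.2.2.im = 0 ∧ 0 ≤ p.2.2.re)}).ncard ≤ 4) := by
  refine (fun hneg => ⟨hneg, fun hfin hcard => ?_⟩ : _ → _ ∧ _) ?_
  swap
  · rintro ⟨x, y, z⟩ ⟨h₁, h₂, h₃⟩
    exact ⟨by linear_combination h₁, by linear_combination h₂, by linear_combination h₃⟩
  have hhalf := two_mul_ncard_le_of_inter_neg_subset (a := 0) hfin hneg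
    (Set.sep_subset _ fun p => (p.1.im = 0 ∧ 0 ≤ p.1.re) ∧ (p.2.1.im = 0 ∧ 0 ≤ p.2.1.re) ∧
      (p.2.2.im = 0 ∧ 0 ≤ p.2.2.re)) ?_
  · omega
  · rintro _ ⟨⟨-, h₁, h₂, h₃⟩, q, ⟨-, k₁, k₂, k₃⟩, rfl⟩
    have hq : q = 0 := Prod.ext (Complex.eq_zero_of_nonneg_of_neg k₁ h₁.2)
      (Prod.ext (Complex.eq_zero_of_nonneg_of_neg k₂ h₂.2)
        (Complex.eq_zero_of_nonneg_of_neg k₃ h₃.2))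
    simp [hq]
end

section
/- Let (Z, d_Z) be a metric space and β > 0. For x, y ∈ Z and s, t ∈ [0,1], define d̃_β((x,s),(y,t)) := β·√(t² + s² − 2 t s · cos(π · min(d_Z(x,y)/β, 1))). Then d̃_β satisfies the triangle inequality: for all x, y, z ∈ Z and all s, t, u ∈ [0,1], d̃_β((x,s),(z,u)) ≤ d̃_β((x,s),(y,t)) + d̃_β((y,t),(z,u)). -/
/-- The law of cosines for two complex numbers in polar form. -/
theorem Complex.norm_polar_sub_polar (r q φ ψ : ℝ) :
    ‖(⟨r * Real.cos φ, r * Real.sin φ⟩ - ⟨q * Real.cos ψ, q * Real.sin ψ⟩ : ℂ)‖ =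
      √(q ^ 2 + r ^ 2 - 2 * q * r * Real.cos (ψ - φ)) := by
  rw [Complex.norm_def, Complex.normSq_apply, Real.cos_sub]
  congr 1
  simp only [Complex.sub_re, Complex.sub_im]
  linear_combination r ^ 2 * Real.sin_sq_add_cos_sq φ + q ^ 2 * Real.sin_sq_add_cos_sq ψ

/-- The triangle inequality for planar points with polar angles `0`, `a` and `a + b`. -/
theorem Real.sqrt_law_cos_add_le (s t u a b : ℝ) :
    √(u ^ 2 + s ^ 2 - 2 * u * s * Real.cos (a + b)) ≤
      √(t ^ 2 + s ^ 2 - 2 * t * s * Real.cos a) +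
        √(u ^ 2 + t ^ 2 - 2 * u * t * Real.cos b) := by
  have h := norm_sub_le_norm_sub_add_norm_sub
    (⟨s * Real.cos 0, s * Real.sin 0⟩ : ℂ) ⟨t * Real.cos a, t * Real.sin a⟩
    ⟨u * Real.cos (a + b), u * Real.sin (a + b)⟩
  simpa only [Complex.norm_polar_sub_polar, sub_zero, add_sub_cancel_left] using h

/-- The side opposite an angle in `[0, π]` grows with that angle. -/
theorem Real.sqrt_law_cos_mono {s t a b : ℝ} (hs : 0 ≤ s) (ht : 0 ≤ t) (ha : 0 ≤ a)
    (hb : b ≤ Real.pi) (hab : a ≤ b) :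
    √(t ^ 2 + s ^ 2 - 2 * t * s * Real.cos a) ≤ √(t ^ 2 + s ^ 2 - 2 * t * s * Real.cos b) := by
  have := Real.cos_le_cos_of_nonneg_of_le_pi ha hb hab
  gcongr

theorem stmt_12 {Z : Type*} [MetricSpace Z] (β : ℝ) (hβ : 0 < β)
    (x y z : Z) (s t u : ℝ)
    (hs : s ∈ Set.Icc (0 : ℝ) 1) (ht : t ∈ Set.Icc (0 : ℝ) 1)
    (hu : u ∈ Set.Icc (0 : ℝ) 1) :
    coneDist β x s z u ≤ coneDist β x s y t + coneDist β y t z u := by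
  have hπ := Real.pi_pos
  have angle_nonneg (v w : Z) : 0 ≤ Real.pi * min (dist v w / β) 1 := by positivity
  have angle_le (v w : Z) : Real.pi * min (dist v w / β) 1 ≤ Real.pi :=
    mul_le_of_le_one_right hπ.le (min_le_right _ _)
  have hdist : dist x z / β ≤ dist x y / β + dist y z / β := by
    rw [← add_div]
    exact div_le_div_of_nonneg_right (dist_triangle x y z) hβ.le
  have angle_add : Real.pi * min (dist x z / β) 1 ≤
      Real.pi * min (dist x y / β) 1 + Real.pi * min (dist y z / β) 1 := by
    rw [← mul_add]
    refine mul_le_mul_of_nonneg_left ?_ hπ.le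
    have hxy : 0 ≤ dist x y / β := by positivity
    have hyz : 0 ≤ dist y z / β := by positivity
    grind
  unfold coneDist
  rw [← mul_add]
  refine mul_le_mul_of_nonneg_left ?_ hβ.le
  have hxy := angle_nonneg x y
  have hyz := angle_nonneg y z
  have hxz := angle_nonneg x z
  have hxy' := angle_le x y
  have hyz' := angle_le y z
  have hxz' := angle_le x z
  generalize Real.pi * min (dist x y / β) 1 = a at *
  generalize Real.pi * min (dist y z / β) 1 = b at *
  generalize Real.pi * min (dist x z / β) 1 = c at *
  have hmin : 0 ≤ min b (Real.pi - a) := le_min hyz (sub_nonneg.2 hxy')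
  calc √(u ^ 2 + s ^ 2 - 2 * u * s * Real.cos c)
      ≤ √(u ^ 2 + s ^ 2 - 2 * u * s * Real.cos (a + min b (Real.pi - a))) :=
        Real.sqrt_law_cos_mono hs.1 hu.1 hxz
          (by linarith [min_le_right b (Real.pi - a)])
          (by rw [← sub_le_iff_le_add']; exact le_min (by linarith) (by linarith))
    _ ≤ _ := Real.sqrt_law_cos_add_le s t u a _
    _ ≤ _ := add_le_add le_rfl
        (Real.sqrt_law_cos_mono ht.1 hu.1 hmin hyz' (min_le_left _ _))
end

section
/- Let c ∈ (0, 1) and define f(s,t) := s² + t² − 2 s t c for real s, t. Then f is not injective on pairs ordered coordinatewise upward: there exist (s,t) and (s′,t′) in [0,1]² with s < s′ and t < t′ such that f(s,t) = f(s′,t′). -/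
theorem stmt_13 (c : ℝ) (hc : c ∈ Set.Ioo (0 : ℝ) 1) :
    ∃ s t s' t' : ℝ, s ∈ Set.Icc (0 : ℝ) 1 ∧ t ∈ Set.Icc (0 : ℝ) 1 ∧
      s' ∈ Set.Icc (0 : ℝ) 1 ∧ t' ∈ Set.Icc (0 : ℝ) 1 ∧
      s < s' ∧ t < t' ∧
      s ^ 2 + t ^ 2 - 2 * s * t * c = s' ^ 2 + t' ^ 2 - 2 * s' * t' * c := by
  obtain ⟨h0, h1⟩ := hc
  have hpos : 0 < c ^ 2 := by positivity
  have hlt : c ^ 2 < 1 := by nlinarith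
  refine ⟨0, 1 / 2 - 3 * c ^ 2 / 8, c / 2, 1 / 2 - c ^ 2 / 8, ⟨le_rfl, zero_le_one⟩,
    ⟨?_, ?_⟩, ⟨?_, ?_⟩, ⟨?_, ?_⟩, ?_, ?_, by ring⟩ <;> linarith
end
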